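/- Let V₁, V₂ : ℝ² → ℝ² be smooth (C^∞) vector fields that are bounded and have bounded derivatives of every order, and let gⁿ : ℝ → ℝ² be the 'spinning straight line' approximation gⁿ_t = (t + hⁿ·¹_t, hⁿ·²_t). For each natural number n ≥ 1 let yⁿ : [0,1] → ℝ² solve (yⁿ)′(t) = (gⁿ·¹)′(t)·V₁(yⁿ_t) + (gⁿ·²)′(t)·V₂(yⁿ_t), i.e. (yⁿ)′(t) = (1 − n sin(n²t))·V₁(yⁿ_t) + n cos(n²t)·V₂(yⁿ_t), with yⁿ_0 = ξ, and let y : [0,1] → ℝ² solve y′(t) = V₁(y_t) + (1/2)·[V₁,V₂](y_t) with y_0 = ξ, where [V₁,V₂](z) = DV₂(z)(V₁(z)) − DV₁(z)(V₂(z)). Then yⁿ converges to y uniformly on [0,1] as n → ∞. -/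

import Mathlib

open Filter Topology Set

section AveragingPrinciple

variable {E G : Type*} [NormedAddCommGroup E] [NormedSpace ℝ E]
  [NormedAddCommGroup G] [NormedSpace ℝ G]

/-- A differentiable map which is bounded together with its derivative. -/
def IsBoundedC1 (f : E → G) : Prop :=
  Differentiable ℝ f ∧ ∃ C : ℝ, ∀ z, ‖f z‖ ≤ C ∧ ‖fderiv ℝ f z‖ ≤ C

namespace IsBoundedC1

theorem add {f g : E → G} (hf : IsBoundedC1 f) (hg : IsBoundedC1 g) :
    IsBoundedC1 (fun z => f z + g z) := by
  obtain ⟨hfd, C, hC⟩ := hf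
  obtain ⟨hgd, D, hD⟩ := hg
  refine ⟨hfd.fun_add hgd, C + D, fun z =>
    ⟨norm_add_le_of_le (hC z).1 (hD z).1, ?_⟩⟩
  rw [fderiv_fun_add (hfd z) (hgd z)]
  exact norm_add_le_of_le (hC z).2 (hD z).2

theorem const_smul {f : E → G} (hf : IsBoundedC1 f) (a : ℝ) :
    IsBoundedC1 (fun z => a • f z) := by
  obtain ⟨hfd, C, hC⟩ := hf
  refine ⟨hfd.fun_const_smul a, |a| * C, fun z => ⟨?_, ?_⟩⟩
  · rw [norm_smul, Real.norm_eq_abs]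
    exact mul_le_mul_of_nonneg_left (hC z).1 (abs_nonneg a)
  · rw [fderiv_fun_const_smul (hfd z), norm_smul, Real.norm_eq_abs]
    exact mul_le_mul_of_nonneg_left (hC z).2 (abs_nonneg a)

theorem sub {f g : E → G} (hf : IsBoundedC1 f) (hg : IsBoundedC1 g) :
    IsBoundedC1 (fun z => f z - g z) := by
  simpa [sub_eq_add_neg] using hf.add (hg.const_smul (-1))

theorem clm_apply {c : E → E →L[ℝ] G} {u : E → E} (hc : IsBoundedC1 c) (hu : IsBoundedC1 u) :
    IsBoundedC1 (fun z => c z (u z)) := by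
  obtain ⟨hcd, C, hC⟩ := hc
  obtain ⟨hud, D, hD⟩ := hu
  have hC0 : 0 ≤ C := (norm_nonneg _).trans (hC 0).1
  have hD0 : 0 ≤ D := (norm_nonneg _).trans (hD 0).1
  refine ⟨hcd.clm_apply hud, C * D + C * D, fun z => ⟨?_, ?_⟩⟩
  · exact ((c z).le_of_opNorm_le_of_le (hC z).1 (hD z).1).trans
      (le_add_of_nonneg_left (by positivity))
  · rw [fderiv_clm_apply (hcd z) (hud z)]
    refine norm_add_le_of_le ?_ ?_
    · exact (ContinuousLinearMap.opNorm_comp_le _ _).trans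
        (mul_le_mul (hC z).1 (hD z).2 (norm_nonneg _) hC0)
    · refine ContinuousLinearMap.le_of_opNorm_le_of_le _ ?_ (hD z).1
      rw [ContinuousLinearMap.opNorm_flip]
      exact (hC z).2

theorem of_iteratedFDeriv {f : E → G} (hf : ContDiff ℝ (⊤ : ℕ∞) f)
    (hb : ∀ k : ℕ, ∃ C : ℝ, ∀ z, ‖iteratedFDeriv ℝ k f z‖ ≤ C) :
    IsBoundedC1 f := by
  obtain ⟨C, hC⟩ := hb 0
  obtain ⟨D, hD⟩ := hb 1
  refine ⟨hf.differentiable (by simp), max C D, fun z => ⟨?_, ?_⟩⟩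
  · rw [← norm_iteratedFDeriv_zero (𝕜 := ℝ)]
    exact (hC z).trans (le_max_left _ _)
  · rw [← norm_iteratedFDeriv_one]
    exact (hD z).trans (le_max_right _ _)

theorem fderiv_of_iteratedFDeriv {f : E → G} (hf : ContDiff ℝ (⊤ : ℕ∞) f)
    (hb : ∀ k : ℕ, ∃ C : ℝ, ∀ z, ‖iteratedFDeriv ℝ k f z‖ ≤ C) :
    IsBoundedC1 (fderiv ℝ f) := by
  refine of_iteratedFDeriv (hf.fderiv_right (by simp)) fun k => ?_
  simpa only [norm_iteratedFDeriv_fderiv] using hb (k + 1)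

theorem eventually_bound {f : E → G} (hf : IsBoundedC1 f) :
    ∀ᶠ M : ℝ in atTop, ∀ z, ‖f z‖ ≤ M ∧ ‖fderiv ℝ f z‖ ≤ M := by
  obtain ⟨-, C, hC⟩ := hf
  filter_upwards [eventually_ge_atTop C] with M hM z
  exact ⟨(hC z).1.trans hM, (hC z).2.trans hM⟩

end IsBoundedC1

theorem norm_smul_add_smul_le {a b α M : ℝ} {u v : G} (ha : |a| ≤ α) (hb : |b| ≤ α)
    (hu : ‖u‖ ≤ M) (hv : ‖v‖ ≤ M) : ‖a • u + b • v‖ ≤ 2 * (α * M) := by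
  have hα : 0 ≤ α := (abs_nonneg a).trans ha
  rw [two_mul]
  refine norm_add_le_of_le ?_ ?_ <;> rw [norm_smul, Real.norm_eq_abs] <;> gcongr

theorem hasDerivAt_inv_mul_cos_sq_mul {N : ℝ} (hN : N ≠ 0) (t : ℝ) :
    HasDerivAt (fun t => N⁻¹ * Real.cos (N ^ 2 * t)) (-(N * Real.sin (N ^ 2 * t))) t := by
  have h := (((hasDerivAt_id t).const_mul (N ^ 2)).cos).const_mul N⁻¹
  refine h.congr_deriv ?_
  simp only [id]
  field_simp

theorem hasDerivAt_inv_mul_sin_sq_mul {N : ℝ} (hN : N ≠ 0) (t : ℝ) :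
    HasDerivAt (fun t => N⁻¹ * Real.sin (N ^ 2 * t)) (N * Real.cos (N ^ 2 * t)) t := by
  have h := (((hasDerivAt_id t).const_mul (N ^ 2)).sin).const_mul N⁻¹
  refine h.congr_deriv ?_
  simp only [id]
  field_simp

theorem hasDerivAt_inv_sq_mul_cos_two_mul {N : ℝ} (hN : N ≠ 0) (t : ℝ) :
    HasDerivAt (fun t => N⁻¹ ^ 2 * (Real.cos (2 * (N ^ 2 * t)) / 4))
      (-(Real.sin (2 * (N ^ 2 * t)) / 2)) t := by
  have h := (((((hasDerivAt_id t).const_mul (N ^ 2)).const_mul 2).cos).div_const 4).const_mul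
    (N⁻¹ ^ 2)
  refine h.congr_deriv ?_
  simp only [id]
  field_simp
  ring

theorem hasDerivAt_inv_sq_mul_sin_two_mul {N : ℝ} (hN : N ≠ 0) (t : ℝ) :
    HasDerivAt (fun t => N⁻¹ ^ 2 * (Real.sin (2 * (N ^ 2 * t)) / 4))
      (Real.cos (2 * (N ^ 2 * t)) / 2) t := by
  have h := (((((hasDerivAt_id t).const_mul (N ^ 2)).const_mul 2).sin).div_const 4).const_mul
    (N⁻¹ ^ 2)
  refine h.congr_deriv ?_
  simp only [id]
  field_simp
  ring

theorem HasDerivAt.smul_comp_fderiv {a : ℝ → ℝ} {a' t : ℝ} {x : ℝ → E} {x' : E} {f : E → G}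
    (hf : Differentiable ℝ f) (ha : HasDerivAt a a' t) (hx : HasDerivAt x x' t) :
    HasDerivAt (fun t => a t • f (x t)) (a t • fderiv ℝ f (x t) x' + a' • f (x t)) t :=
  ha.fun_smul ((hf (x t)).hasFDerivAt.comp_hasDerivAt t hx)

/-- Let `x` be driven by the spinning straight line at frequency `N ^ 2`. If the vector fields
and the Lie-derivative-type compositions are bounded in `C¹` by `M`, then `x` remains within
distance `O(1 / N)` of the trajectory of the limiting vector field. -/
theorem dist_spinning_le {V₁ V₂ : E → E} {M N : ℝ} (hM : 1 ≤ M) (hN : 1 ≤ N)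
    (hd₁ : Differentiable ℝ V₁) (hd₂ : Differentiable ℝ V₂)
    {A B F : E → E} (hA : Differentiable ℝ A) (hB : Differentiable ℝ B) (hF : Differentiable ℝ F)
    (hA_def : ∀ z, A z = fderiv ℝ V₁ z (V₁ z) - fderiv ℝ V₂ z (V₂ z))
    (hB_def : ∀ z, B z = fderiv ℝ V₁ z (V₂ z) + fderiv ℝ V₂ z (V₁ z))
    (hF_def : ∀ z, F z =
      V₁ z + (1 / 2 : ℝ) • (fderiv ℝ V₂ z (V₁ z) - fderiv ℝ V₁ z (V₂ z)))
    (b₁ : ∀ z, ‖V₁ z‖ ≤ M) (b₂ : ∀ z, ‖V₂ z‖ ≤ M)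
    (b₁₁ : ∀ z, ‖fderiv ℝ V₁ z (V₁ z)‖ ≤ M) (b₂₁ : ∀ z, ‖fderiv ℝ V₂ z (V₁ z)‖ ≤ M)
    (bA : ∀ z, ‖A z‖ ≤ M ∧ ‖fderiv ℝ A z‖ ≤ M) (bB : ∀ z, ‖B z‖ ≤ M ∧ ‖fderiv ℝ B z‖ ≤ M)
    (bF : ∀ z, ‖fderiv ℝ F z‖ ≤ M) {ξ : E} {x y : ℝ → E}
    (hx0 : x 0 = ξ)
    (hx : ∀ t ∈ Icc (0 : ℝ) 1, HasDerivAt x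
      ((1 - N * Real.sin (N ^ 2 * t)) • V₁ (x t) + (N * Real.cos (N ^ 2 * t)) • V₂ (x t)) t)
    (hy0 : y 0 = ξ) (hy : ∀ t ∈ Icc (0 : ℝ) 1, HasDerivAt y (F (y t)) t)
    {t : ℝ} (ht : t ∈ Icc (0 : ℝ) 1) :
    dist (x t) (y t) ≤
      N⁻¹ * (3 * M + (3 * M * Real.exp M + 7 * M ^ 2 / M * (Real.exp M - 1))) := by
  have hN0 : N ≠ 0 := by positivity
  have hi0 : 0 < N⁻¹ := by positivity
  have hi1 : N⁻¹ ≤ 1 := inv_le_one_of_one_le₀ hN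
  have hM0 : 0 < M := by positivity
  let w : ℝ → E := fun t => x t -
    ((N⁻¹ * Real.cos (N ^ 2 * t)) • V₁ (x t) + (N⁻¹ * Real.sin (N ^ 2 * t)) • V₂ (x t)) +
    ((N⁻¹ ^ 2 * (Real.cos (2 * (N ^ 2 * t)) / 4)) • A (x t) +
      (N⁻¹ ^ 2 * (Real.sin (2 * (N ^ 2 * t)) / 4)) • B (x t))
  let x' : ℝ → E := fun t =>
    (1 - N * Real.sin (N ^ 2 * t)) • V₁ (x t) + (N * Real.cos (N ^ 2 * t)) • V₂ (x t)
  let r : ℝ → E := fun t => -((N⁻¹ * Real.cos (N ^ 2 * t)) • fderiv ℝ V₁ (x t) (V₁ (x t)) +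
      (N⁻¹ * Real.sin (N ^ 2 * t)) • fderiv ℝ V₂ (x t) (V₁ (x t))) +
    ((N⁻¹ ^ 2 * (Real.cos (2 * (N ^ 2 * t)) / 4)) • fderiv ℝ A (x t) (x' t) +
      (N⁻¹ ^ 2 * (Real.sin (2 * (N ^ 2 * t)) / 4)) • fderiv ℝ B (x t) (x' t))
  have hw : ∀ t ∈ Icc (0 : ℝ) 1, HasDerivAt w (F (x t) + r t) t := by
    intro t ht
    have h := ((hx t ht).fun_sub
      ((HasDerivAt.smul_comp_fderiv hd₁ (hasDerivAt_inv_mul_cos_sq_mul hN0 t) (hx t ht)).fun_add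
      (HasDerivAt.smul_comp_fderiv hd₂ (hasDerivAt_inv_mul_sin_sq_mul hN0 t) (hx t ht)))).fun_add
      ((HasDerivAt.smul_comp_fderiv hA (hasDerivAt_inv_sq_mul_cos_two_mul hN0 t) (hx t ht)).fun_add
      (HasDerivAt.smul_comp_fderiv hB (hasDerivAt_inv_sq_mul_sin_two_mul hN0 t) (hx t ht)))
    refine h.congr_deriv ?_
    have hs := Real.sin_sq_add_cos_sq (N ^ 2 * t)
    simp only [r, x']
    generalize fderiv ℝ A (x t) _ = DA
    generalize fderiv ℝ B (x t) _ = DB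
    simp only [hF_def, hA_def, hB_def, map_add, map_smul, Real.sin_two_mul, Real.cos_two_mul]
    generalize Real.sin (N ^ 2 * t) = s at *
    generalize Real.cos (N ^ 2 * t) = c at *
    match_scalars <;> field_simp <;> first | ring1 | linear_combination (2 * N) * hs
  have hcos : ∀ θ : ℝ, |N⁻¹ * Real.cos θ| ≤ N⁻¹ := fun θ => by
    rw [abs_mul, abs_of_pos hi0]
    exact mul_le_of_le_one_right hi0.le (Real.abs_cos_le_one θ)
  have hsin : ∀ θ : ℝ, |N⁻¹ * Real.sin θ| ≤ N⁻¹ := fun θ => by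
    rw [abs_mul, abs_of_pos hi0]
    exact mul_le_of_le_one_right hi0.le (Real.abs_sin_le_one θ)
  have hcos2 : ∀ θ : ℝ, |N⁻¹ ^ 2 * (Real.cos θ / 4)| ≤ N⁻¹ ^ 2 / 4 := fun θ => by
    rw [abs_mul, abs_of_pos (pow_pos hi0 2), abs_div, abs_of_pos (by norm_num : (0 : ℝ) < 4)]
    nlinarith [Real.abs_cos_le_one θ, pow_pos hi0 2]
  have hsin2 : ∀ θ : ℝ, |N⁻¹ ^ 2 * (Real.sin θ / 4)| ≤ N⁻¹ ^ 2 / 4 := fun θ => by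
    rw [abs_mul, abs_of_pos (pow_pos hi0 2), abs_div, abs_of_pos (by norm_num : (0 : ℝ) < 4)]
    nlinarith [Real.abs_sin_le_one θ, pow_pos hi0 2]
  have hxw : ∀ t, dist (x t) (w t) ≤ N⁻¹ * (3 * M) := by
    intro t
    have h1 := norm_smul_add_smul_le (hcos (N ^ 2 * t)) (hsin (N ^ 2 * t)) (b₁ (x t)) (b₂ (x t))
    have h2 := norm_smul_add_smul_le (hcos2 (2 * (N ^ 2 * t))) (hsin2 (2 * (N ^ 2 * t)))
      (bA (x t)).1 (bB (x t)).1
    have h3 := norm_sub_le_of_le h1 h2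
    have h4 : N⁻¹ ^ 2 * M ≤ N⁻¹ * M := by
      gcongr
      exact pow_le_of_le_one hi0.le hi1 two_ne_zero
    rw [dist_eq_norm]
    simp only [w]
    refine (le_of_eq (congrArg _ ?_)).trans (h3.trans (by nlinarith))
    abel
  have hr : ∀ t, ‖r t‖ ≤ N⁻¹ * (4 * M ^ 2) := by
    intro t
    have hx' : ‖x' t‖ ≤ 2 * ((1 + N) * M) := by
      refine norm_smul_add_smul_le ?_ ?_ (b₁ _) (b₂ _)
      · rw [abs_le]
        constructor <;> nlinarith [Real.sin_le_one (N ^ 2 * t), Real.neg_one_le_sin (N ^ 2 * t)]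
      · rw [abs_le]
        constructor <;> nlinarith [Real.cos_le_one (N ^ 2 * t), Real.neg_one_le_cos (N ^ 2 * t)]
    have h1 := norm_smul_add_smul_le (hcos (N ^ 2 * t)) (hsin (N ^ 2 * t)) (b₁₁ (x t)) (b₂₁ (x t))
    have h2 := norm_smul_add_smul_le (hcos2 (2 * (N ^ 2 * t))) (hsin2 (2 * (N ^ 2 * t)))
      (ContinuousLinearMap.le_of_opNorm_le_of_le _ (bA (x t)).2 hx')
      (ContinuousLinearMap.le_of_opNorm_le_of_le _ (bB (x t)).2 hx')
    refine (norm_add_le_of_le ((norm_neg _).trans_le h1) h2).trans ?_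
    have h3 : N⁻¹ * M ≤ N⁻¹ * M ^ 2 := by
      gcongr
      exact le_self_pow₀ hM two_ne_zero
    have h4 : N⁻¹ ^ 2 * M ^ 2 ≤ N⁻¹ * M ^ 2 := by
      gcongr
      exact pow_le_of_le_one hi0.le hi1 two_ne_zero
    have h5 : 2 * (N⁻¹ ^ 2 / 4 * (M * (2 * ((1 + N) * M)))) =
        N⁻¹ ^ 2 * M ^ 2 + N⁻¹ * M ^ 2 := by
      field_simp
      ring
    linarith
  have hLip : LipschitzWith ⟨M, hM0.le⟩ F :=
    lipschitzWith_of_nnnorm_fderiv_le hF fun z => bF z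
  have hwF : ∀ t, dist (F (x t) + r t) (F (w t)) ≤ N⁻¹ * (7 * M ^ 2) := by
    intro t
    have h1 : dist (F (x t)) (F (w t)) ≤ M * (N⁻¹ * (3 * M)) :=
      (hLip.dist_le_mul _ _).trans (mul_le_mul_of_nonneg_left (hxw t) hM0.le)
    have h2 : dist (F (x t) + r t) (F (x t)) ≤ N⁻¹ * (4 * M ^ 2) := by
      simpa [dist_eq_norm] using hr t
    linarith [dist_triangle (F (x t) + r t) (F (x t)) (F (w t))]
  have hgron := dist_le_of_approx_trajectories_ODE (v := fun _ => F) (K := ⟨M, hM0.le⟩)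
    (f := w) (g := y) (f' := fun t => F (x t) + r t) (g' := fun t => F (y t))
    (a := 0) (b := 1) (εf := N⁻¹ * (7 * M ^ 2)) (εg := 0) (δ := N⁻¹ * (3 * M))
    (fun _ => hLip) (fun t ht => (hw t ht).continuousAt.continuousWithinAt)
    (fun t ht => (hw t (Ico_subset_Icc_self ht)).hasDerivWithinAt) (fun t _ => hwF t)
    (fun t ht => (hy t ht).continuousAt.continuousWithinAt)
    (fun t ht => (hy t (Ico_subset_Icc_self ht)).hasDerivWithinAt) (fun t _ => by simp)
    (by rw [hy0, ← hx0, dist_comm]; exact hxw 0) t ht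
  have hmono : gronwallBound (N⁻¹ * (3 * M)) M (N⁻¹ * (7 * M ^ 2) + 0) (t - 0) ≤
      N⁻¹ * (3 * M * Real.exp M + 7 * M ^ 2 / M * (Real.exp M - 1)) := by
    have he : Real.exp (M * (t - 0)) ≤ Real.exp M :=
      Real.exp_le_exp.2 (mul_le_of_le_one_right hM0.le (by linarith [ht.2]))
    rw [gronwallBound_of_K_ne_0 hM0.ne']
    calc N⁻¹ * (3 * M) * Real.exp (M * (t - 0)) +
          (N⁻¹ * (7 * M ^ 2) + 0) / M * (Real.exp (M * (t - 0)) - 1)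
        ≤ N⁻¹ * (3 * M) * Real.exp M + (N⁻¹ * (7 * M ^ 2) + 0) / M * (Real.exp M - 1) := by
          gcongr
      _ = _ := by ring
  linarith [dist_triangle (x t) (w t) (y t), hxw t, hgron.trans hmono]

end AveragingPrinciple


/-- Let `V₁, V₂ : ℝ² → ℝ²` be smooth vector fields, bounded with bounded derivatives of
every order, and let `gⁿ_t = (t + (1/n)cos(n²t), (1/n)sin(n²t))` be the spinning straight
line approximation. Let `yⁿ` solve
`(yⁿ)′(t) = (1 − n sin(n²t))·V₁(yⁿ_t) + n cos(n²t)·V₂(yⁿ_t)` with `yⁿ_0 = ξ`, and let `y`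
solve `y′(t) = V₁(y_t) + (1/2)·[V₁,V₂](y_t)` with `y_0 = ξ`, where
`[V₁,V₂](z) = DV₂(z)(V₁(z)) − DV₁(z)(V₂(z))`. Then `yⁿ → y` uniformly on `[0,1]`. -/
theorem stmt9 (V₁ V₂ : EuclideanSpace ℝ (Fin 2) → EuclideanSpace ℝ (Fin 2))
    (hV₁ : ContDiff ℝ (⊤ : ℕ∞) V₁) (hV₂ : ContDiff ℝ (⊤ : ℕ∞) V₂)
    (hV₁b : ∀ k : ℕ, ∃ C : ℝ, ∀ z, ‖iteratedFDeriv ℝ k V₁ z‖ ≤ C)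
    (hV₂b : ∀ k : ℕ, ∃ C : ℝ, ∀ z, ‖iteratedFDeriv ℝ k V₂ z‖ ≤ C)
    (ξ : EuclideanSpace ℝ (Fin 2))
    (yn : ℕ → ℝ → EuclideanSpace ℝ (Fin 2)) (y : ℝ → EuclideanSpace ℝ (Fin 2))
    (hyn0 : ∀ n : ℕ, 1 ≤ n → yn n 0 = ξ)
    (hyn : ∀ n : ℕ, 1 ≤ n → ∀ t ∈ Set.Icc (0 : ℝ) 1,
      HasDerivAt (yn n)
        ((1 - (n : ℝ) * Real.sin ((n : ℝ) ^ 2 * t)) • V₁ (yn n t) +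
          ((n : ℝ) * Real.cos ((n : ℝ) ^ 2 * t)) • V₂ (yn n t)) t)
    (hy0 : y 0 = ξ)
    (hy : ∀ t ∈ Set.Icc (0 : ℝ) 1,
      HasDerivAt y
        (V₁ (y t) +
          (1 / 2 : ℝ) • (fderiv ℝ V₂ (y t) (V₁ (y t)) - fderiv ℝ V₁ (y t) (V₂ (y t)))) t) :
    TendstoUniformlyOn (fun n => yn n) y Filter.atTop (Set.Icc (0 : ℝ) 1) := by
  have h₁ := IsBoundedC1.of_iteratedFDeriv hV₁ hV₁b
  have h₂ := IsBoundedC1.of_iteratedFDeriv hV₂ hV₂b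
  have hD₁ := IsBoundedC1.fderiv_of_iteratedFDeriv hV₁ hV₁b
  have hD₂ := IsBoundedC1.fderiv_of_iteratedFDeriv hV₂ hV₂b
  have hA := (hD₁.clm_apply h₁).sub (hD₂.clm_apply h₂)
  have hB := (hD₁.clm_apply h₂).add (hD₂.clm_apply h₁)
  have hF := h₁.add (((hD₂.clm_apply h₁).sub (hD₁.clm_apply h₂)).const_smul (1 / 2))
  obtain ⟨M, hM, b₁, b₂, b₁₁, b₂₁, bA, bB, bF⟩ := ((eventually_ge_atTop (1 : ℝ)).and <|
    h₁.eventually_bound.and <| h₂.eventually_bound.and <|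
    (hD₁.clm_apply h₁).eventually_bound.and <| (hD₂.clm_apply h₁).eventually_bound.and <|
    hA.eventually_bound.and <| hB.eventually_bound.and hF.eventually_bound).exists
  rw [Metric.tendstoUniformlyOn_iff]
  intro ε hε
  have hlim : Tendsto (fun n : ℕ => (n : ℝ)⁻¹ *
      (3 * M + (3 * M * Real.exp M + 7 * M ^ 2 / M * (Real.exp M - 1)))) atTop (𝓝 0) := by
    simpa using (tendsto_inv_atTop_nhds_zero_nat (𝕜 := ℝ)).mul_const
      (3 * M + (3 * M * Real.exp M + 7 * M ^ 2 / M * (Real.exp M - 1)))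
  filter_upwards [hlim.eventually_lt_const hε, eventually_ge_atTop 1] with n hn hn1 t ht
  rw [dist_comm]
  exact (dist_spinning_le hM (by exact_mod_cast hn1) h₁.1 h₂.1 hA.1 hB.1 hF.1
    (fun _ => rfl) (fun _ => rfl) (fun _ => rfl) (fun z => (b₁ z).1) (fun z => (b₂ z).1)
    (fun z => (b₁₁ z).1) (fun z => (b₂₁ z).1) bA bB (fun z => (bF z).2)
    (hyn0 n hn1) (hyn n hn1) hy0 hy ht).trans_lt hn
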